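/- Let R = M_n(F) be endowed with a division G-grading with support T. Then R admits an F-linear anti-automorphism φ (a linear bijection with φ(xy) = φ(y)φ(x) for all x,y) satisfying φ(R_g) = R_g for all g ∈ G if and only if every element of T satisfies t² = e, i.e., T is an elementary abelian 2-group. -/

import Mathlib

namespace Module.End

/-- A pairwise commuting family of endomorphisms of a nonzero finite-dimensional vector space over
an algebraically closed field has a common eigenvector. -/
theorem exists_common_eigenvector_of_commute {F V ι : Type*} [Field F] [IsAlgClosed F]
    [AddCommGroup V] [Module F V] [FiniteDimensional F V] [Nontrivial V]
    (f : ι → Module.End F V) (hf : ∀ i j, Commute (f i) (f j)) :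
    ∃ v : V, v ≠ 0 ∧ ∀ i, ∃ c : F, f i v = c • v := by
  obtain ⟨W, ⟨hW0, hWf⟩, hmin⟩ := WellFounded.has_min
    (wellFounded_lt (α := Submodule F V))
    {W | W ≠ ⊥ ∧ ∀ i, ∀ w ∈ W, f i w ∈ W} ⟨⊤, top_ne_bot, fun _ _ _ => trivial⟩
  obtain ⟨v, hvW, hv0⟩ := W.exists_mem_ne_zero_of_ne_bot hW0
  refine ⟨v, hv0, fun i => ?_⟩
  have : Nontrivial W := Submodule.nontrivial_iff_ne_bot.2 hW0
  obtain ⟨c, hc⟩ := Module.End.exists_eigenvalue ((f i).restrict (hWf i))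
  obtain ⟨w, hw⟩ := hc.exists_hasEigenvector
  refine ⟨c, ?_⟩
  by_contra hvc
  refine hmin (W ⊓ Module.End.eigenspace (f i) c) ⟨?_, ?_⟩ (lt_of_le_of_ne inf_le_left ?_)
  · refine (Submodule.ne_bot_iff _).2 ⟨w, ⟨w.2, ?_⟩, fun h => hw.2 (Subtype.ext h)⟩
    exact Module.End.mem_eigenspace_iff.2 (congrArg Subtype.val hw.apply_eq_smul)
  · rintro j u ⟨huW, hu⟩
    refine ⟨hWf j u huW, ?_⟩
    have hu' := Module.End.mem_eigenspace_iff.1 hu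
    refine Module.End.mem_eigenspace_iff.2 ?_
    rw [← Module.End.mul_apply, (hf i j).eq, Module.End.mul_apply, hu', map_smul]
  · intro h
    exact hvc (Module.End.mem_eigenspace_iff.1 (inf_eq_left.1 h hvW))

end Module.End

namespace DirectSum.IsInternal

section

variable {F A G : Type*} [Field F] [AddCommGroup A] [Module F A] [DecidableEq G]
  {ℛ : G → Submodule F A}

theorem homogeneous_induction (hℛ : DirectSum.IsInternal ℛ) {P : A → Prop} (zero : P 0)
    (add : ∀ x y, P x → P y → P (x + y)) (homog : ∀ g, ∀ x ∈ ℛ g, P x) (x : A) : P x := by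
  have hx : x ∈ ⨆ g, ℛ g := hℛ.submodule_iSup_eq_top ▸ Submodule.mem_top
  exact Submodule.iSup_induction ℛ (motive := P) hx homog zero add

theorem exists_proj (hℛ : DirectSum.IsInternal ℛ) :
    ∃ p : G → A →ₗ[F] A, (∀ g, ∀ x ∈ ℛ g, p g x = x) ∧
      (∀ g h, h ≠ g → ∀ x ∈ ℛ h, p g x = 0) ∧ ∀ g x, p g x ∈ ℛ g := by
  let _ := hℛ.chooseDecomposition
  refine ⟨fun g => (ℛ g).subtype ∘ₗ DirectSum.component F G (fun g => ℛ g) g ∘ₗ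
    (DirectSum.decomposeLinearEquiv ℛ).toLinearMap, fun g x hx => ?_, fun g h hg x hx => ?_,
    fun g x => Subtype.property _⟩
  · exact DirectSum.decompose_of_mem_same ℛ hx
  · exact DirectSum.decompose_of_mem_ne ℛ hx hg

theorem eq_of_mem_of_mem (hℛ : DirectSum.IsInternal ℛ) {g h : G} {x : A} (hx : x ≠ 0)
    (hg : x ∈ ℛ g) (hh : x ∈ ℛ h) : g = h := by
  obtain ⟨p, hp, hp', -⟩ := hℛ.exists_proj
  by_contra hne
  exact hx ((hp h x hh).symm.trans (hp' h g hne x hg))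

end

variable {F A G : Type*} [Field F] [Ring A] [Algebra F A] [CommGroup G] [DecidableEq G]
  {ℛ : G → Submodule F A}

theorem one_mem (hℛ : DirectSum.IsInternal ℛ)
    (hmul : ∀ g h : G, ∀ x ∈ ℛ g, ∀ y ∈ ℛ h, x * y ∈ ℛ (g * h)) : (1 : A) ∈ ℛ 1 := by
  obtain ⟨p, hp, hp', hmem⟩ := hℛ.exists_proj
  have key : ∀ h, ∀ x ∈ ℛ h, ∀ y, p h (x * y) = x * p 1 y := by
    intro h x hx y
    induction y using hℛ.homogeneous_induction with
    | zero => simp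
    | add y z hy hz => simp only [mul_add, map_add, hy, hz]
    | homog k y hy =>
      have hxy := hmul h k x hx y hy
      by_cases hk : k = 1
      · subst hk
        rw [hp 1 y hy, hp h _ (by simpa using hxy)]
      · rw [hp' 1 k hk y hy, hp' h (h * k) (by simpa using hk) _ hxy, mul_zero]
  have hone : ∀ x, x * p 1 1 = x := by
    intro x
    induction x using hℛ.homogeneous_induction with
    | zero => simp
    | add y z hy hz => rw [add_mul, hy, hz]
    | homog h x hx => rw [← key h x hx, mul_one, hp h x hx]
  rw [← hone 1, one_mul]
  exact hmem 1 1

end DirectSum.IsInternal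

theorem Submodule.exists_smul_eq_of_finrank_le_one {F V : Type*} [Field F] [AddCommGroup V]
    [Module F V] [FiniteDimensional F V] {W : Submodule F V} (hW : Module.finrank F W ≤ 1)
    {x y : V} (hx : x ∈ W) (hx0 : x ≠ 0) (hy : y ∈ W) : ∃ c : F, y = c • x := by
  have h1 : Module.finrank F W = 1 := by
    refine le_antisymm hW (Submodule.one_le_finrank_iff.2 ?_)
    exact (Submodule.ne_bot_iff _).2 ⟨x, hx, hx0⟩
  obtain ⟨c, hc⟩ := exists_smul_eq_of_finrank_eq_one h1 (x := (⟨x, hx⟩ : W))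
    (fun h => hx0 (congrArg Subtype.val h)) ⟨y, hy⟩
  exact ⟨c, (congrArg Subtype.val hc).symm⟩

namespace Matrix

variable {F G ι : Type*} [Field F] [CommGroup G] [DecidableEq G] [Fintype ι] [DecidableEq ι]
  {ℛ : G → Submodule F (Matrix ι ι F)}

theorem isUnit_of_mem_division_grading (hℛ : DirectSum.IsInternal ℛ)
    (hmul : ∀ g h : G, ∀ x ∈ ℛ g, ∀ y ∈ ℛ h, x * y ∈ ℛ (g * h))
    (hdim : ∀ g : G, Module.finrank F (ℛ g) ≤ 1)
    {g : G} {x : Matrix ι ι F} (hx : x ∈ ℛ g) (hx0 : x ≠ 0) : IsUnit x := by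
  by_contra hu
  obtain ⟨i₀, j₀, hij⟩ : ∃ i j, x i j ≠ 0 := by
    by_contra! h
    exact hx0 (Matrix.ext h)
  have hne : Nonempty ι := ⟨i₀⟩
  have h1 := hℛ.one_mem hmul
  obtain ⟨p, hp, hp', -⟩ := hℛ.exists_proj
  have key : ∀ a b, p 1 (a * x * b) = 0 := by
    intro a b
    induction a using hℛ.homogeneous_induction with
    | zero => simp
    | add a a' h h' => simp only [add_mul, map_add, h, h', add_zero]
    | homog h a ha =>
    induction b using hℛ.homogeneous_induction with
    | zero => simp
    | add a a' h h' => simp only [mul_add, map_add, h, h', add_zero]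
    | homog k b hb =>
    have hm := hmul _ _ _ (hmul _ _ _ ha _ hx) _ hb
    by_cases hd : h * g * k = 1
    · rw [hd] at hm
      obtain ⟨c, hc⟩ := Submodule.exists_smul_eq_of_finrank_le_one (hdim 1) h1 one_ne_zero hm
      suffices c = 0 by rw [hc, this, zero_smul, map_zero]
      by_contra hc0
      have hdet := congrArg det hc
      rw [isUnit_iff_isUnit_det, isUnit_iff_ne_zero, not_not] at hu
      rw [det_mul, det_mul, hu, mul_zero, zero_mul, det_smul, det_one, mul_one] at hdet
      exact pow_ne_zero _ hc0 hdet.symm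
    · exact hp' _ _ hd _ hm
  have hsum : ∑ i, single i i₀ (1 : F) * x * single j₀ i 1 = x i₀ j₀ • (1 : Matrix ι ι F) := by
    simp only [single_mul_mul_single, one_mul, mul_one]
    rw [← diagonal_one, ← diagonal_smul, ← sum_single_eq_diagonal]
    simp
  have hzero : p 1 (x i₀ j₀ • (1 : Matrix ι ι F)) = 0 := by
    rw [← hsum, map_sum]
    exact Finset.sum_eq_zero fun i _ => key _ _
  rw [map_smul, hp 1 1 h1] at hzero
  exact (smul_ne_zero hij one_ne_zero) hzero

theorem exists_smul_eq_mul_comm_of_mem_division_grading (hℛ : DirectSum.IsInternal ℛ)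
    (hmul : ∀ g h : G, ∀ x ∈ ℛ g, ∀ y ∈ ℛ h, x * y ∈ ℛ (g * h))
    (hdim : ∀ g : G, Module.finrank F (ℛ g) ≤ 1) {g h : G} {x y : Matrix ι ι F}
    (hx : x ∈ ℛ g) (hx0 : x ≠ 0) (hy : y ∈ ℛ h) (hy0 : y ≠ 0) :
    x * y ≠ 0 ∧ ∃ c : F, y * x = c • (x * y) := by
  have hxy : x * y ≠ 0 := fun h0 => hy0
    ((isUnit_of_mem_division_grading hℛ hmul hdim hx hx0).mul_right_eq_zero.1 h0)
  exact ⟨hxy, Submodule.exists_smul_eq_of_finrank_le_one (hdim (g * h)) (hmul _ _ _ hx _ hy) hxy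
    (mul_comm g h ▸ hmul _ _ _ hy _ hx)⟩

/-- The support of a division grading of a matrix algebra admitting a degree-preserving
anti-automorphism has exponent dividing two. -/
theorem sq_eq_one_of_division_grading_antiautomorphism (hℛ : DirectSum.IsInternal ℛ)
    (hmul : ∀ g h : G, ∀ x ∈ ℛ g, ∀ y ∈ ℛ h, x * y ∈ ℛ (g * h))
    (hdim : ∀ g : G, Module.finrank F (ℛ g) ≤ 1)
    (φ : Matrix ι ι F ≃ₗ[F] Matrix ι ι F) (hφ : ∀ x y, φ (x * y) = φ y * φ x)
    (hφℛ : ∀ g, ∀ x ∈ ℛ g, φ x ∈ ℛ g) {t : G} (ht : ℛ t ≠ ⊥) : t ^ 2 = 1 := by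
  obtain ⟨x, hx, hx0⟩ := (ℛ t).exists_mem_ne_zero_of_ne_bot ht
  have hxx : x * x ∈ ℛ (t * t) := hmul _ _ _ hx _ hx
  have hxx0 : x * x ≠ 0 :=
    (exists_smul_eq_mul_comm_of_mem_division_grading hℛ hmul hdim hx hx0 hx hx0).1
  have hcomm : ∀ y, Commute (x * x) y := by
    intro y
    induction y using hℛ.homogeneous_induction with
    | zero => exact Commute.zero_right _
    | add y z hy hz => exact hy.add_right hz
    | homog h y hy =>
    by_cases hy0 : y = 0
    · simp [hy0]
    obtain ⟨hxy0, b, hb⟩ :=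
      exists_smul_eq_mul_comm_of_mem_division_grading hℛ hmul hdim hx hx0 hy hy0
    obtain ⟨l, hl⟩ := Submodule.exists_smul_eq_of_finrank_le_one (hdim t) hx hx0 (hφℛ t x hx)
    obtain ⟨m, hm⟩ := Submodule.exists_smul_eq_of_finrank_le_one (hdim h) hy hy0 (hφℛ h y hy)
    obtain ⟨k, hk⟩ := Submodule.exists_smul_eq_of_finrank_le_one (hdim (t * h))
      (hmul _ _ _ hx _ hy) hxy0 (hφℛ _ _ (hmul _ _ _ hx _ hy))
    have e1 : k = m * l * b := by
      have := hφ x y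
      rw [hk, hl, hm, smul_mul_smul_comm, hb, smul_smul] at this
      exact smul_left_injective F hxy0 this
    have e2 : b * k = l * m := by
      have := hφ y x
      rw [hb, map_smul, hk, hl, hm, smul_mul_smul_comm, smul_smul] at this
      exact smul_left_injective F hxy0 this
    have hl0 : l ≠ 0 := by
      rintro rfl
      exact hx0 (φ.map_eq_zero_iff.1 (by rw [hl, zero_smul]))
    have hm0 : m ≠ 0 := by
      rintro rfl
      exact hy0 (φ.map_eq_zero_iff.1 (by rw [hm, zero_smul]))
    have hb2 : b * b = 1 := by
      refine mul_left_cancel₀ (mul_ne_zero hl0 hm0) ?_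
      rw [e1] at e2
      linear_combination e2
    change x * x * y = y * (x * x)
    rw [← mul_assoc y, hb, smul_mul_assoc, mul_assoc x y x, hb, mul_smul_comm, smul_smul, hb2,
      one_smul, mul_assoc]
  obtain ⟨c, hc⟩ := mem_range_scalar_of_commute_single (M := x * x) fun i j _ => (hcomm _).symm
  have hmem : x * x ∈ ℛ 1 := by
    rw [← hc, scalar_apply, ← smul_one_eq_diagonal]
    exact (ℛ 1).smul_mem c (hℛ.one_mem hmul)
  rw [pow_two]
  exact hℛ.eq_of_mem_of_mem hxx0 hxx hmem

/-- A division grading of a matrix algebra whose support has exponent dividing two admits a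
degree-preserving anti-automorphism, of the form `x ↦ S⁻¹ * xᵀ * S`. -/
theorem exists_antiautomorphism_of_division_grading_sq_eq_one [IsAlgClosed F] [Nonempty ι]
    (hℛ : DirectSum.IsInternal ℛ)
    (hmul : ∀ g h : G, ∀ x ∈ ℛ g, ∀ y ∈ ℛ h, x * y ∈ ℛ (g * h))
    (hdim : ∀ g : G, Module.finrank F (ℛ g) ≤ 1) (hT : ∀ t, ℛ t ≠ ⊥ → t ^ 2 = 1) :
    ∃ φ : Matrix ι ι F ≃ₗ[F] Matrix ι ι F, (∀ x y, φ (x * y) = φ y * φ x) ∧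
      ∀ g, ∀ x ∈ ℛ g, φ x ∈ ℛ g := by
  have hsq : ∀ g, ∀ x ∈ ℛ g, x ≠ 0 → ∃ c : F, c ≠ 0 ∧ x * x = c • 1 := by
    intro g x hx hx0
    have hxx := hmul _ _ _ hx _ hx
    rw [← pow_two g, hT g ((Submodule.ne_bot_iff _).2 ⟨x, hx, hx0⟩)] at hxx
    obtain ⟨c, hc⟩ :=
      Submodule.exists_smul_eq_of_finrank_le_one (hdim 1) (hℛ.one_mem hmul) one_ne_zero hxx
    refine ⟨c, ?_, hc⟩
    rintro rfl
    rw [zero_smul] at hc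
    exact (exists_smul_eq_mul_comm_of_mem_division_grading hℛ hmul hdim hx hx0 hx hx0).1 hc
  have hcomm : ∀ g h, ∀ x ∈ ℛ g, ∀ y ∈ ℛ h, ∃ b : F, b * b = 1 ∧ y * x = b • (x * y) := by
    intro g h x hx y hy
    by_cases hx0 : x = 0
    · exact ⟨1, by simp, by simp [hx0]⟩
    by_cases hy0 : y = 0
    · exact ⟨1, by simp, by simp [hy0]⟩
    obtain ⟨-, b, hb⟩ :=
      exists_smul_eq_mul_comm_of_mem_division_grading hℛ hmul hdim hx hx0 hy hy0
    obtain ⟨c, hc0, hc⟩ := hsq g x hx hx0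
    refine ⟨b, ?_, hb⟩
    have e : y * (x * x) = (b * b) • (x * x * y) := by
      rw [← mul_assoc y, hb, smul_mul_assoc, mul_assoc x y x, hb, mul_smul_comm, smul_smul,
        mul_assoc]
    rw [hc, mul_smul_comm, mul_one, smul_mul_assoc, one_mul, smul_smul] at e
    exact mul_right_cancel₀ hc0 ((smul_left_injective F hy0 e).symm.trans (one_mul c).symm)
  let L : {x : Matrix ι ι F // ∃ g, x ∈ ℛ g} → Module.End F (Matrix ι ι F) := fun x =>
    LinearMap.mulLeftRight F (x.1ᵀ, x.1)
  have hL : ∀ x y, Commute (L x) (L y) := by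
    rintro ⟨x, g, hx⟩ ⟨y, h, hy⟩
    obtain ⟨b, hb, hyx⟩ := hcomm g h x hx y hy
    refine LinearMap.ext fun M => ?_
    simp only [L, Module.End.mul_apply, LinearMap.mulLeftRight_apply]
    calc xᵀ * (yᵀ * M * y) * x = (y * x)ᵀ * M * (y * x) := by
          simp only [transpose_mul, mul_assoc]
      _ = (b * b) • ((x * y)ᵀ * M * (x * y)) := by
          rw [hyx, transpose_smul, smul_mul_assoc, smul_mul_smul_comm]
      _ = yᵀ * (xᵀ * M * x) * y := by
          rw [hb, one_smul]
          simp only [transpose_mul, mul_assoc]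
  obtain ⟨S, hS0, hS⟩ := Module.End.exists_common_eigenvector_of_commute L hL
  have hSx : ∀ g, ∀ x ∈ ℛ g, x ≠ 0 → ∃ c : F, c ≠ 0 ∧ xᵀ * S = c • (S * x) := by
    intro g x hx hx0
    obtain ⟨e, he⟩ := hS ⟨x, g, hx⟩
    obtain ⟨c, hc0, hc⟩ := hsq g x hx hx0
    replace he : xᵀ * S * x = e • S := he
    have h1 : c • (xᵀ * S) = e • (S * x) := by
      rw [← smul_mul_assoc e, ← he, mul_assoc _ x x, hc, mul_smul_comm, mul_one]
    have h2 : xᵀ * S = (c⁻¹ * e) • (S * x) := by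
      rw [mul_smul, ← h1, inv_smul_smul₀ hc0]
    refine ⟨_, fun h0 => hS0 ?_, h2⟩
    rw [h0, zero_smul] at h2
    have hu := isUnit_of_mem_division_grading hℛ hmul hdim hx hx0
    exact ((isUnit_transpose x).2 hu).mul_right_eq_zero.1 h2
  have hSdet : S.det ≠ 0 := by
    intro hdet
    obtain ⟨v, hv0, hv⟩ := exists_mulVec_eq_zero_iff.2 hdet
    have hall : ∀ x, (S * x) *ᵥ v = 0 := by
      intro x
      induction x using hℛ.homogeneous_induction with
      | zero => simp
      | add y z hy hz => rw [mul_add, add_mulVec, hy, hz, add_zero]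
      | homog g x hx =>
      by_cases hx0 : x = 0
      · simp [hx0]
      obtain ⟨c, hc0, hc⟩ := hSx g x hx hx0
      have := congrArg (· *ᵥ v) hc
      simp only [← mulVec_mulVec, hv, mulVec_zero, smul_mulVec] at this
      rw [← mulVec_mulVec]
      exact (smul_eq_zero.1 this.symm).resolve_left hc0
    obtain ⟨j, hj⟩ := Function.ne_iff.1 hv0
    refine hS0 (Matrix.ext fun i k => ?_)
    have := congrFun (hall (single k j 1)) i
    rw [← mulVec_mulVec, single_mulVec] at this
    change (S *ᵥ Pi.single k (1 * v j)) i = 0 at this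
    rw [mulVec_single] at this
    simpa [show v j ≠ 0 from hj] using this
  have hSu : IsUnit S.det := isUnit_iff_ne_zero.2 hSdet
  let φ : Matrix ι ι F →ₗ[F] Matrix ι ι F :=
    LinearMap.mulLeftRight F (S⁻¹, S) ∘ₗ (transposeLinearEquiv ι ι F F).toLinearMap
  have hφ : ∀ x, φ x = S⁻¹ * xᵀ * S := fun x => rfl
  have hinj : Function.Injective φ := by
    intro x y hxy
    rw [hφ, hφ] at hxy
    have := congrArg (fun z => S * z * S⁻¹) hxy
    simpa [mul_assoc, mul_nonsing_inv_cancel_left _ _ hSu, mul_nonsing_inv _ hSu] using this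
  refine ⟨LinearEquiv.ofInjectiveEndo φ hinj, fun x y => ?_, fun g x hx => ?_⟩
  · rw [LinearEquiv.coe_ofInjectiveEndo]
    simp only [hφ, transpose_mul, mul_assoc, mul_nonsing_inv_cancel_left _ _ hSu]
  · rw [LinearEquiv.coe_ofInjectiveEndo, hφ]
    by_cases hx0 : x = 0
    · simp [hx0]
    obtain ⟨c, -, hc⟩ := hSx g x hx hx0
    rw [mul_assoc, hc, mul_smul_comm, nonsing_inv_mul_cancel_left _ _ hSu]
    exact (ℛ g).smul_mem c hx

end Matrix


/-- `Mₙ(F)` with a division `G`-grading admits a grading-preserving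
`F`-linear anti-automorphism iff the support is an elementary abelian 2-group. -/
theorem division_grading_antiautomorphism_iff
    {F : Type*} [Field F] [IsAlgClosed F]
    {G : Type*} [CommGroup G] [DecidableEq G] {n : ℕ}
    (ℛ : G → Submodule F (Matrix (Fin n) (Fin n) F))
    (hinternal : DirectSum.IsInternal ℛ)
    (hmul : ∀ g h : G, ∀ x ∈ ℛ g, ∀ y ∈ ℛ h, x * y ∈ ℛ (g * h))
    (hdim : ∀ g : G, Module.finrank F (ℛ g) ≤ 1) :
    (∃ φ : Matrix (Fin n) (Fin n) F ≃ₗ[F] Matrix (Fin n) (Fin n) F,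
      (∀ x y : Matrix (Fin n) (Fin n) F, φ (x * y) = φ y * φ x) ∧
      (∀ g : G, (ℛ g).map (φ : Matrix (Fin n) (Fin n) F →ₗ[F] Matrix (Fin n) (Fin n) F)
        = ℛ g)) ↔
    (∀ t : G, ℛ t ≠ ⊥ → t ^ 2 = 1) := by
  constructor
  · rintro ⟨φ, hφ, hφℛ⟩ t ht
    exact Matrix.sq_eq_one_of_division_grading_antiautomorphism hinternal hmul hdim φ hφ
      (fun g x hx => (hφℛ g).le (Submodule.mem_map_of_mem hx)) ht
  · intro hT
    rcases isEmpty_or_nonempty (Fin n) with _ | _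
    · exact ⟨LinearEquiv.refl F _, fun _ _ => Subsingleton.elim _ _, fun g => Submodule.map_id _⟩
    obtain ⟨φ, hφ, hφℛ⟩ :=
      Matrix.exists_antiautomorphism_of_division_grading_sq_eq_one hinternal hmul hdim hT
    exact ⟨φ, hφ, fun g => Submodule.eq_of_le_of_finrank_eq
      (Submodule.map_le_iff_le_comap.2 (hφℛ g)) (LinearEquiv.finrank_map_eq φ (ℛ g))⟩
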